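/- Fix an integer K ≥ 0 and define s_n = Σ_{0 ≤ r ≤ K} ℙ(E_r^{(n)}) for n ≥ 1, where E_r^{(n)} are the row-growth events of the Plancherel growth process. Then for each n ≥ 1, s_n ≤ (K+1)/√n. -/

import Mathlib

open MeasureTheory Filter

/-- The number of standard Young tableaux of shape `μ`: bijective fillings of the cells of `μ`
by `0, 1, …, μ.card - 1` that are strictly increasing along rows and columns. -/
noncomputable def sytCount (μ : YoungDiagram) : ℕ :=
  Nat.card {T : μ.cells → Fin μ.card //
    Function.Bijective T ∧
      ∀ a b : μ.cells, (a : ℕ × ℕ).1 ≤ (b : ℕ × ℕ).1 → (a : ℕ × ℕ).2 ≤ (b : ℕ × ℕ).2 →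
        a ≠ b → T a < T b}

/-- `lam 0 ↗ lam 1 ↗ ⋯` is a Plancherel growth process: the probability of any prescribed
initial path `∅ = μ⁽⁰⁾ ↗ μ⁽¹⁾ ↗ ⋯ ↗ μ⁽ⁿ⁾` in the Young graph equals `d_{μ⁽ⁿ⁾} / n!`,
which characterizes the distribution of the sequence of RSK shapes of an i.i.d. uniform
sequence. -/
def IsPlancherelGrowthProcess {Ω : Type*} [MeasurableSpace Ω] (P : Measure Ω)
    (lam : ℕ → Ω → YoungDiagram) : Prop :=
  IsProbabilityMeasure P ∧
  (∀ (n : ℕ) (y : YoungDiagram), MeasurableSet {ω | lam n ω = y}) ∧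
  ∀ (n : ℕ) (path : ℕ → YoungDiagram), path 0 = ⊥ →
    (∀ i, i < n → path i ≤ path (i + 1) ∧ (path (i + 1)).card = (path i).card + 1) →
    P {ω | ∀ i ≤ n, lam i ω = path i} =
      (sytCount (path n) : ENNReal) / (Nat.factorial n : ENNReal)

/-- The event `E_r⁽ⁿ⁺¹⁾` that the box added in step `n+1` of the growth process
(i.e. the unique box of `λ⁽ⁿ⁺¹⁾ ∖ λ⁽ⁿ⁾`) lies in the row with index `r`. -/
def growthEvent {Ω : Type*} (lam : ℕ → Ω → YoungDiagram) (n r : ℕ) : Set Ω :=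
  {ω | (lam (n + 1) ω).rowLen r = (lam n ω).rowLen r + 1}

open Finset in
theorem yfin (n : ℕ) : {μ : YoungDiagram | μ.card = n}.Finite := by
  have h : ((range n ×ˢ range n).powerset : Set (Finset (ℕ × ℕ))).Finite := Finset.finite_toSet _
  refine Set.Finite.of_finite_image (f := YoungDiagram.cells) (h.subset ?_) ?_
  · rintro _ ⟨μ, hμ, rfl⟩
    simp only [Set.mem_ofPred_eq] at hμ
    simp only [coe_powerset, Set.mem_preimage, Set.mem_powerset_iff, coe_subset]
    rintro ⟨i, j⟩ hij
    have hsub1 : (range (i+1)).image (fun k => (k, j)) ⊆ μ.cells := by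
      intro x hx
      simp only [mem_image, mem_range] at hx
      obtain ⟨k, hk, rfl⟩ := hx
      exact μ.up_left_mem (by omega) le_rfl hij
    have hsub2 : (range (j+1)).image (fun k => (i, k)) ⊆ μ.cells := by
      intro x hx
      simp only [mem_image, mem_range] at hx
      obtain ⟨k, hk, rfl⟩ := hx
      exact μ.up_left_mem le_rfl (by omega) hij
    have h1 := card_le_card hsub1
    have h2 := card_le_card hsub2
    rw [card_image_of_injective _ (fun a b h => by simpa using h), card_range] at h1 h2
    simp only [mem_product, mem_range]
    change _ ≤ μ.card at h1
    change _ ≤ μ.card at h2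
    omega
  · intro a _ b _ h
    exact YoungDiagram.ext h

noncomputable def Yd (n : ℕ) : Finset YoungDiagram := (yfin n).toFinset

theorem mem_Yd {n : ℕ} {μ : YoungDiagram} : μ ∈ Yd n ↔ μ.card = n := by simp [Yd]

theorem card_bot' : (⊥ : YoungDiagram).card = 0 := by
  show (⊥ : YoungDiagram).cells.card = 0
  simp

theorem card_zero {μ : YoungDiagram} (h : μ.card = 0) : μ = ⊥ := by
  apply YoungDiagram.ext
  have : μ.cells = ∅ := Finset.card_eq_zero.mp h
  simpa using this

def Fs (n : ℕ) (ν : YoungDiagram) : Set (ℕ × ℕ → ℕ) :=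
  {T | (∀ c ∈ ν, T c < n) ∧ (∀ c, c ∉ ν → T c = n) ∧ (∀ a ∈ ν, ∀ b ∈ ν, T a = T b → a = b) ∧
    ∀ a ∈ ν, ∀ b ∈ ν, a.1 ≤ b.1 → a.2 ≤ b.2 → a ≠ b → T a < T b}

open Classical in
noncomputable def Feq (ν : YoungDiagram) : {T : ν.cells → Fin ν.card //
    Function.Bijective T ∧
      ∀ a b : ν.cells, (a : ℕ × ℕ).1 ≤ (b : ℕ × ℕ).1 → (a : ℕ × ℕ).2 ≤ (b : ℕ × ℕ).2 →
        a ≠ b → T a < T b} ≃ Fs ν.card ν where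
  toFun T := ⟨fun c => if h : c ∈ ν.cells then (T.1 ⟨c, h⟩ : ℕ) else ν.card, by
    refine ⟨?_, ?_, ?_, ?_⟩
    · intro c hc
      rw [← YoungDiagram.mem_cells] at hc
      simp [hc, -YoungDiagram.mem_cells]
    · intro c hc
      rw [← YoungDiagram.mem_cells] at hc
      simp [hc, -YoungDiagram.mem_cells]
    · intro a ha b hb h
      rw [← YoungDiagram.mem_cells] at ha hb
      simp only [ha, hb, dif_pos] at h
      have := T.2.1.1 (Fin.ext h)
      simpa using this
    · intro a ha b hb h1 h2 h3
      rw [← YoungDiagram.mem_cells] at ha hb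
      simp only [ha, hb, dif_pos]
      exact T.2.2 ⟨a, ha⟩ ⟨b, hb⟩ h1 h2 (by simpa using h3)⟩
  invFun T := ⟨fun c => ⟨T.1 c, T.2.1 c (by simpa using c.2)⟩, by
    have hinj : Function.Injective (fun c : ν.cells =>
        (⟨T.1 c, T.2.1 c (by simpa using c.2)⟩ : Fin ν.card)) := by
      intro a b h
      simp only [Fin.mk.injEq] at h
      exact Subtype.ext (T.2.2.2.1 a (by simpa using a.2) b (by simpa using b.2) h)
    refine ⟨(Fintype.bijective_iff_injective_and_card _).2 ⟨hinj, by simp⟩, ?_⟩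
    intro a b h1 h2 h3
    exact T.2.2.2.2 a (by simpa using a.2) b (by simpa using b.2) h1 h2
      (fun h => h3 (Subtype.ext h))⟩
  left_inv T := by
    apply Subtype.ext
    funext c
    apply Fin.ext
    have := c.2
    simp [-YoungDiagram.mem_cells]
  right_inv T := by
    apply Subtype.ext
    funext c
    by_cases h : c ∈ ν.cells
    · simp [h, -YoungDiagram.mem_cells]
    · simp only [h, dif_neg, not_false_eq_true]
      exact (T.2.2.1 c (by simpa using h)).symm

theorem Fs_fin {n : ℕ} {ν : YoungDiagram} (h : ν.card = n) : (Fs n ν).Finite := by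
  subst h
  have := Finite.of_equiv _ (Feq ν)
  exact Set.toFinite _

theorem sytCount_eq {n : ℕ} {ν : YoungDiagram} (h : ν.card = n) :
    sytCount ν = (Fs n ν).ncard := by
  subst h
  exact Nat.card_congr (Feq ν)

theorem sytCount_bot : sytCount ⊥ = 1 := by
  rw [sytCount_eq card_bot', Set.ncard_eq_one]
  refine ⟨fun _ => 0, ?_⟩
  ext T
  simp only [Fs, YoungDiagram.notMem_bot, Set.mem_ofPred_eq, Set.mem_singleton_iff]
  constructor
  · intro h; funext c; exact h.2.1 c (by simp)
  · rintro rfl; simp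

theorem single_of_card {κ ν : YoungDiagram} (hle : κ ≤ ν) (hc : ν.card = κ.card + 1) :
    ∃ c, c ∈ ν ∧ c ∉ κ ∧ ∀ x ∈ ν, x ∉ κ → x = c := by
  have hs : κ.cells ⊆ ν.cells := hle
  have : (ν.cells \ κ.cells).card = 1 := by
    rw [Finset.card_sdiff_of_subset hs]
    have : ν.cells.card = κ.cells.card + 1 := hc
    omega
  obtain ⟨c, hc⟩ := Finset.card_eq_one.mp this
  have h2 : ∀ x, x ∈ ν ∧ x ∉ κ ↔ x = c := by
    intro x
    have := Finset.ext_iff.mp hc x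
    simpa using this
  exact ⟨c, ((h2 c).2 rfl).1, ((h2 c).2 rfl).2, fun x h h' => (h2 x).1 ⟨h, h'⟩⟩

open Classical in
theorem sytCount_rec {n : ℕ} {ν : YoungDiagram} (h : ν.card = n + 1) :
    sytCount ν = ∑ κ ∈ (Yd n).filter (· ≤ ν), sytCount κ := by
  set F : YoungDiagram → Finset (ℕ × ℕ → ℕ) := fun κ =>
    if hk : κ.card = n then (Fs_fin hk).toFinset else ∅ with hF
  have hFm : ∀ κ, κ.card = n → ∀ T, T ∈ F κ ↔ T ∈ Fs n κ := by
    intro κ hk T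
    simp [hF, hk]
  have hFc : ∀ κ ∈ (Yd n).filter (· ≤ ν), sytCount κ = (F κ).card := by
    intro κ hk
    have hk : κ.card = n := mem_Yd.mp (Finset.mem_filter.mp hk).1
    rw [sytCount_eq hk, Set.ncard_eq_toFinset_card _ (Fs_fin hk)]
    simp [hF, hk]
  rw [Finset.sum_congr rfl hFc, ← Finset.card_biUnion, sytCount_eq h,
    Set.ncard_eq_toFinset_card _ (Fs_fin h)]
  · apply Finset.card_bij (fun T _ => fun c => min (T c) n)
    · intro T hT
      have hT : T ∈ Fs (n+1) ν := by simpa using hT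
      obtain ⟨h1, h2, h3, h4⟩ := hT
      have himg : ν.cells.image T = Finset.range (n+1) := by
        apply Finset.eq_of_subset_of_card_le
        · intro x hx
          obtain ⟨c, hc, rfl⟩ := Finset.mem_image.mp hx
          exact Finset.mem_range.mpr (h1 c (by simpa using hc))
        · rw [Finset.card_image_of_injOn]
          · rw [Finset.card_range]; exact h.ge
          · intro a ha b hb hab
            exact h3 a (by simpa using ha) b (by simpa using hb) hab
      have hlow : IsLowerSet ((ν.cells.filter (fun c => T c < n) : Finset (ℕ × ℕ)) : Set (ℕ × ℕ)) := by
        intro b a hab hb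
        simp only [Finset.coe_filter, YoungDiagram.mem_cells, Set.mem_ofPred_eq] at hb ⊢
        have ha : a ∈ ν := ν.isLowerSet hab hb.1
        refine ⟨ha, ?_⟩
        by_cases hne : a = b
        · rw [hne]; exact hb.2
        · exact (h4 a ha b hb.1 hab.1 hab.2 hne).trans hb.2
      let κ : YoungDiagram := ⟨ν.cells.filter (fun c => T c < n), hlow⟩
      have hm : ∀ c, c ∈ κ ↔ c ∈ ν ∧ T c < n := by
        intro c
        show c ∈ ν.cells.filter (fun c => T c < n) ↔ _
        simp
      have hκ : κ.card = n := by
        show (ν.cells.filter (fun c => T c < n)).card = n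
        rw [← Finset.card_image_of_injOn (f := T)]
        · have : (ν.cells.filter (fun c => T c < n)).image T = Finset.range n := by
            ext x
            simp only [Finset.mem_image, Finset.mem_filter, Finset.mem_range]
            constructor
            · rintro ⟨c, hc, rfl⟩; exact hc.2
            · intro hx
              have : x ∈ ν.cells.image T := by rw [himg]; simp; omega
              obtain ⟨c, hc, rfl⟩ := Finset.mem_image.mp this
              exact ⟨c, ⟨hc, hx⟩, rfl⟩
          rw [this, Finset.card_range]
        · intro a ha b hb hab
          simp at ha hb
          exact h3 a ha.1 b hb.1 hab
      refine Finset.mem_biUnion.mpr ⟨κ, Finset.mem_filter.mpr ⟨mem_Yd.mpr hκ, ?_⟩, ?_⟩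
      · intro c hc
        exact ((hm c).1 hc).1
      · rw [hFm _ hκ]
        refine ⟨?_, ?_, ?_, ?_⟩
        · intro c hc
          have := ((hm c).1 hc).2
          show min (T c) n < n
          omega
        · intro c hc
          show min (T c) n = n
          by_cases hcν : c ∈ ν
          · have : ¬ T c < n := fun hh => hc ((hm c).2 ⟨hcν, hh⟩)
            omega
          · have := h2 c hcν
            omega
        · intro a ha b hb hab
          have ha := (hm a).1 ha
          have hb := (hm b).1 hb
          apply h3 a ha.1 b hb.1
          simp only at hab
          omega
        · intro a ha b hb i1 i2 i3
          have ha := (hm a).1 ha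
          have hb := (hm b).1 hb
          have := h4 a ha.1 b hb.1 i1 i2 i3
          show min (T a) n < min (T b) n
          omega
    · intro T hT T' hT' hTT
      have hT : T ∈ Fs (n+1) ν := by simpa using hT
      have hT' : T' ∈ Fs (n+1) ν := by simpa using hT'
      funext c
      by_cases hc : c ∈ ν
      · have i1 := hT.1 c hc
        have i2 := hT'.1 c hc
        have : min (T c) n = min (T' c) n := congrFun hTT c
        omega
      · rw [hT.2.1 c hc, hT'.2.1 c hc]
    · intro T hT
      obtain ⟨κ, hκ, hT⟩ := Finset.mem_biUnion.mp hT
      obtain ⟨hκ1, hκ2⟩ := Finset.mem_filter.mp hκ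
      have hκ1 := mem_Yd.mp hκ1
      rw [hFm κ hκ1] at hT
      obtain ⟨h1, h2, h3, h4⟩ := hT
      obtain ⟨e, he1, he2, he3⟩ := single_of_card hκ2 (by rw [h, hκ1])
      have hle : ∀ c, T c ≤ n := by
        intro c
        by_cases hc : c ∈ κ
        · exact (h1 c hc).le
        · exact (h2 c hc).le
      refine ⟨fun c => if c ∈ ν then T c else n + 1, ?_, ?_⟩
      · rw [Set.Finite.mem_toFinset]
        refine ⟨?_, ?_, ?_, ?_⟩
        · intro c hc
          simp only [hc, if_true]
          have := hle c
          omega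
        · intro c hc
          simp [hc]
        · intro a ha b hb hab
          simp only [ha, hb, if_true] at hab
          by_cases hak : a ∈ κ <;> by_cases hbk : b ∈ κ
          · exact h3 a hak b hbk hab
          · have := h1 a hak
            have := h2 b hbk
            omega
          · have := h2 a hak
            have := h1 b hbk
            omega
          · rw [he3 a ha hak, he3 b hb hbk]
        · intro a ha b hb i1 i2 i3
          simp only [ha, hb, if_true]
          by_cases hbk : b ∈ κ
          · have hak : a ∈ κ := κ.isLowerSet (show a ≤ b from ⟨i1, i2⟩) hbk
            exact h4 a hak b hbk i1 i2 i3
          · rw [h2 b hbk]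
            apply h1
            by_contra hak
            exact i3 (by rw [he3 a ha hak, he3 b hb hbk])
      · funext c
        have := hle c
        by_cases hc : c ∈ ν
        · simp [hc, this]
        · have hk : c ∉ κ := fun hh => hc (hκ2 hh)
          simp [hc, h2 c hk]
  · intro a ha b hb hab
    have ha := mem_Yd.mp (Finset.mem_filter.mp ha).1
    have hb := mem_Yd.mp (Finset.mem_filter.mp hb).1
    rw [Function.onFun, Finset.disjoint_left]
    intro T hTa hTb
    rw [hFm _ ha] at hTa
    rw [hFm _ hb] at hTb
    apply hab
    apply YoungDiagram.ext
    ext c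
    simp only [YoungDiagram.mem_cells]
    constructor
    · intro hc
      by_contra hcb
      have := hTa.1 c hc
      have := hTb.2.1 c hcb
      omega
    · intro hc
      by_contra hcb
      have := hTb.1 c hc
      have := hTa.2.1 c hcb
      omega

theorem le_rowLen {κ ν : YoungDiagram} (h : κ ≤ ν) (r : ℕ) : κ.rowLen r ≤ ν.rowLen r := by
  by_contra hc
  push Not at hc
  have : (r, ν.rowLen r) ∈ κ := YoungDiagram.mem_iff_lt_rowLen.mpr hc
  have := YoungDiagram.mem_iff_lt_rowLen.mp (h this)
  omega

/-- structure of a growth step in row r -/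
theorem step_mem {κ ν : YoungDiagram} (hle : κ ≤ ν) (hc : ν.card = κ.card + 1) {r : ℕ}
    (hr : ν.rowLen r = κ.rowLen r + 1) (c : ℕ × ℕ) :
    c ∈ ν ↔ c ∈ κ ∨ c = (r, κ.rowLen r) := by
  obtain ⟨e, h1, h2, h3⟩ := single_of_card hle hc
  have he : (r, κ.rowLen r) = e := by
    apply h3
    · rw [YoungDiagram.mem_iff_lt_rowLen]; omega
    · rw [YoungDiagram.mem_iff_lt_rowLen]; omega
  rw [he]
  constructor
  · intro hcν
    by_cases hk : c ∈ κ
    · exact Or.inl hk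
    · exact Or.inr (h3 c hcν hk)
  · rintro (h | rfl)
    · exact hle h
    · exact h1

theorem step_row {κ ν : YoungDiagram} (hle : κ ≤ ν) (hc : ν.card = κ.card + 1) :
    ∃ r, ν.rowLen r = κ.rowLen r + 1 := by
  obtain ⟨⟨r, j⟩, h1, h2, h3⟩ := single_of_card hle hc
  refine ⟨r, ?_⟩
  rw [YoungDiagram.mem_iff_lt_rowLen] at h1 h2
  have hx : ∀ x, x < ν.rowLen r → ¬ x < κ.rowLen r → x = j := by
    intro x hx hx'
    have := h3 (r, x) (YoungDiagram.mem_iff_lt_rowLen.mpr hx)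
      (fun h => hx' (YoungDiagram.mem_iff_lt_rowLen.mp h))
    simpa using this
  have a := hx (κ.rowLen r) (by omega) (by omega)
  by_contra hne
  have b := hx (κ.rowLen r + 1) (by omega) (by omega)
  omega

theorem yd_ext {κ ν : YoungDiagram} (h : ∀ c, c ∈ κ ↔ c ∈ ν) : κ = ν := by
  apply YoungDiagram.ext
  ext c
  simpa using h c

theorem step_inj_up {κ ν ν' : YoungDiagram} (hle : κ ≤ ν) (hc : ν.card = κ.card + 1)
    (hle' : κ ≤ ν') (hc' : ν'.card = κ.card + 1) {r : ℕ}
    (hr : ν.rowLen r = κ.rowLen r + 1) (hr' : ν'.rowLen r = κ.rowLen r + 1) : ν = ν' := by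
  apply yd_ext
  intro c
  rw [step_mem hle hc hr, step_mem hle' hc' hr']

theorem step_mem_down {κ ν : YoungDiagram} (hle : κ ≤ ν) (hc : ν.card = κ.card + 1) {r : ℕ}
    (hr : ν.rowLen r = κ.rowLen r + 1) (c : ℕ × ℕ) :
    c ∈ κ ↔ c ∈ ν ∧ c ≠ (r, ν.rowLen r - 1) := by
  rw [step_mem hle hc hr, hr, Nat.add_sub_cancel]
  have : (r, κ.rowLen r) ∉ κ := by rw [YoungDiagram.mem_iff_lt_rowLen]; omega
  constructor
  · intro h
    refine ⟨Or.inl h, ?_⟩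
    rintro rfl
    exact this h
  · tauto

theorem step_inj_down {κ κ' ν : YoungDiagram} (hle : κ ≤ ν) (hc : ν.card = κ.card + 1)
    (hle' : κ' ≤ ν) (hc' : ν.card = κ'.card + 1) {r : ℕ}
    (hr : ν.rowLen r = κ.rowLen r + 1) (hr' : ν.rowLen r = κ'.rowLen r + 1) : κ = κ' := by
  apply yd_ext
  intro c
  rw [step_mem_down hle hc hr, step_mem_down hle' hc' hr']

theorem rowLen_of_iff {κ : YoungDiagram} {r m : ℕ} (h : ∀ j, (r, j) ∈ κ ↔ j < m) :
    κ.rowLen r = m := by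
  have h' : ∀ j, j < κ.rowLen r ↔ j < m := fun j => by
    rw [← YoungDiagram.mem_iff_lt_rowLen]; exact h j
  have := h' m
  have := h' (κ.rowLen r)
  omega

theorem step_row_unique {κ ν : YoungDiagram} (hle : κ ≤ ν) (hc : ν.card = κ.card + 1) {r s : ℕ}
    (hr : ν.rowLen r = κ.rowLen r + 1) (hs : ν.rowLen s = κ.rowLen s + 1) : r = s := by
  have h1 : (s, κ.rowLen s) ∈ ν := by rw [YoungDiagram.mem_iff_lt_rowLen]; omega
  have h2 : (s, κ.rowLen s) ∉ κ := by rw [YoungDiagram.mem_iff_lt_rowLen]; omega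
  have := (step_mem hle hc hr _).1 h1
  simp only [h2, false_or, Prod.mk.injEq] at this
  exact this.1.symm

def Addable (μ : YoungDiagram) : ℕ → Prop
  | 0 => True
  | (r + 1) => μ.rowLen (r + 1) < μ.rowLen r

theorem add_exists (μ : YoungDiagram) (r : ℕ) (h : Addable μ r) :
    ∃ ν, μ ≤ ν ∧ ν.card = μ.card + 1 ∧ ν.rowLen r = μ.rowLen r + 1 := by
  have hnot : (r, μ.rowLen r) ∉ μ := by rw [YoungDiagram.mem_iff_lt_rowLen]; omega
  have hlow : IsLowerSet ((insert (r, μ.rowLen r) μ.cells : Finset (ℕ × ℕ)) : Set (ℕ × ℕ)) := by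
    rintro ⟨i, j⟩ ⟨i', j'⟩ hle hm
    have hle' : i' ≤ i ∧ j' ≤ j := hle
    simp only [Finset.coe_insert, Set.mem_insert_iff, Prod.mk.injEq, Finset.mem_coe,
      YoungDiagram.mem_cells] at hm ⊢
    rcases hm with ⟨rfl, rfl⟩ | hm
    · by_cases hi : i' = i
      · subst hi
        rw [YoungDiagram.mem_iff_lt_rowLen]
        omega
      · right
        rw [YoungDiagram.mem_iff_lt_rowLen]
        cases i with
        | zero => omega
        | succ i =>
          have h : μ.rowLen (i + 1) < μ.rowLen i := h
          have := μ.rowLen_anti i' i (by omega)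
          omega
    · exact Or.inr (μ.up_left_mem hle'.1 hle'.2 hm)
  refine ⟨⟨_, hlow⟩, ?_, ?_, ?_⟩
  · intro c hc
    exact Finset.mem_insert_of_mem (by simpa using hc)
  · exact Finset.card_insert_of_notMem (by simpa using hnot)
  · apply rowLen_of_iff
    intro j
    rw [YoungDiagram.mem_mk]
    simp [YoungDiagram.mem_iff_lt_rowLen]
    omega

theorem rem_exists (μ : YoungDiagram) (r : ℕ) (h : Addable μ (r + 1)) :
    ∃ κ, κ ≤ μ ∧ μ.card = κ.card + 1 ∧ μ.rowLen r = κ.rowLen r + 1 := by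
  have h : μ.rowLen (r + 1) < μ.rowLen r := h
  have hin : (r, μ.rowLen r - 1) ∈ μ := by rw [YoungDiagram.mem_iff_lt_rowLen]; omega
  have hlow : IsLowerSet ((μ.cells.erase (r, μ.rowLen r - 1) : Finset (ℕ × ℕ)) : Set (ℕ × ℕ)) := by
    rintro ⟨i, j⟩ ⟨i', j'⟩ hle hm
    have hle' : i' ≤ i ∧ j' ≤ j := hle
    simp only [Finset.mem_coe, Finset.mem_erase, ne_eq, Prod.mk.injEq,
      YoungDiagram.mem_cells] at hm ⊢
    refine ⟨?_, μ.up_left_mem hle'.1 hle'.2 hm.2⟩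
    rintro ⟨rfl, rfl⟩
    have h2 := YoungDiagram.mem_iff_lt_rowLen.mp hm.2
    by_cases hi : i = i'
    · subst hi
      have := hm.1
      omega
    · have := μ.rowLen_anti (i' + 1) i (by omega)
      omega
  refine ⟨⟨_, hlow⟩, ?_, ?_, ?_⟩
  · intro c hc
    exact (YoungDiagram.mem_cells c).1 (Finset.mem_of_mem_erase hc)
  · have := Finset.card_erase_add_one (s := μ.cells) (a := (r, μ.rowLen r - 1)) (by simpa using hin)
    exact this.symm
  · have : YoungDiagram.rowLen ⟨_, hlow⟩ r = μ.rowLen r - 1 := by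
      apply rowLen_of_iff
      intro j
      rw [YoungDiagram.mem_mk]
      simp [YoungDiagram.mem_iff_lt_rowLen]
      omega
    omega

theorem addable_of_up {μ ν : YoungDiagram} (hle : μ ≤ ν) (hc : ν.card = μ.card + 1) {r : ℕ}
    (hr : ν.rowLen r = μ.rowLen r + 1) : Addable μ r := by
  cases r with
  | zero => trivial
  | succ r =>
    show μ.rowLen (r + 1) < μ.rowLen r
    by_contra hcon
    have h1 := ν.rowLen_anti r (r + 1) (by omega)
    have h2 := μ.rowLen_anti r (r + 1) (by omega)
    have h3 := le_rowLen hle r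
    have h4 : (r, μ.rowLen r) ∈ ν := by rw [YoungDiagram.mem_iff_lt_rowLen]; omega
    rw [step_mem hle hc hr] at h4
    rw [YoungDiagram.mem_iff_lt_rowLen] at h4
    simp at h4

theorem addable_of_down {μ κ : YoungDiagram} (hle : κ ≤ μ) (hc : μ.card = κ.card + 1) {r : ℕ}
    (hr : μ.rowLen r = κ.rowLen r + 1) : Addable μ (r + 1) := by
  show μ.rowLen (r + 1) < μ.rowLen r
  by_contra hcon
  have h1 := μ.rowLen_anti r (r + 1) (by omega)
  have h2 := κ.rowLen_anti r (r + 1) (by omega)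
  have h4 : (r + 1, κ.rowLen r) ∈ μ := by rw [YoungDiagram.mem_iff_lt_rowLen]; omega
  rw [step_mem hle hc hr] at h4
  rw [YoungDiagram.mem_iff_lt_rowLen] at h4
  simp at h4
  omega

theorem addable_lt {μ : YoungDiagram} {r : ℕ} (h : Addable μ r) : r < μ.card + 1 := by
  cases r with
  | zero => omega
  | succ r =>
    have h : μ.rowLen (r + 1) < μ.rowLen r := h
    have hm : (r, 0) ∈ μ := by rw [YoungDiagram.mem_iff_lt_rowLen]; omega
    have hsub : (Finset.range (r+1)).image (fun k => (k, 0)) ⊆ μ.cells := by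
      intro x hx
      simp only [Finset.mem_image, Finset.mem_range] at hx
      obtain ⟨k, hk, rfl⟩ := hx
      exact μ.up_left_mem (by omega) le_rfl hm
    have h1 := Finset.card_le_card hsub
    rw [Finset.card_image_of_injective _ (fun a b h => by simpa using h), Finset.card_range] at h1
    change _ ≤ μ.card at h1
    omega

open Classical in
theorem up_card {n : ℕ} {μ : YoungDiagram} (h : μ.card = n) :
    ((Yd (n + 1)).filter (μ ≤ ·)).card = ((Finset.range (n + 1)).filter (Addable μ)).card := by
  symm
  have hex : ∀ r, ∃ ν, Addable μ r → (μ ≤ ν ∧ ν.card = μ.card + 1 ∧ ν.rowLen r = μ.rowLen r + 1) := by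
    intro r
    by_cases hr : Addable μ r
    · obtain ⟨ν, hν⟩ := add_exists μ r hr
      exact ⟨ν, fun _ => hν⟩
    · exact ⟨⊥, fun h => absurd h hr⟩
  choose f hf using hex
  apply Finset.card_bij (fun r _ => f r)
  · intro r hr
    have := hf r (Finset.mem_filter.mp hr).2
    exact Finset.mem_filter.mpr ⟨mem_Yd.mpr (by rw [this.2.1, h]), this.1⟩
  · intro r hr s hs hrs
    have h1 := hf r (Finset.mem_filter.mp hr).2
    have h2 := hf s (Finset.mem_filter.mp hs).2
    rw [← hrs] at h2
    exact step_row_unique h1.1 h1.2.1 h1.2.2 h2.2.2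
  · intro ν hν
    obtain ⟨h1, h2⟩ := Finset.mem_filter.mp hν
    have hc : ν.card = μ.card + 1 := by rw [mem_Yd.mp h1, h]
    obtain ⟨r, hr⟩ := step_row h2 hc
    have ha := addable_of_up h2 hc hr
    refine ⟨r, Finset.mem_filter.mpr ⟨Finset.mem_range.mpr (h ▸ addable_lt ha), ha⟩, ?_⟩
    have := hf r ha
    exact step_inj_up this.1 this.2.1 h2 hc this.2.2 hr

open Classical in
theorem down_card {n : ℕ} {μ : YoungDiagram} (h : μ.card = n + 1) :
    ((Yd n).filter (· ≤ μ)).card =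
      ((Finset.range (n + 1)).filter (fun r => Addable μ (r + 1))).card := by
  symm
  have hex : ∀ r, ∃ κ, Addable μ (r + 1) →
      (κ ≤ μ ∧ μ.card = κ.card + 1 ∧ μ.rowLen r = κ.rowLen r + 1) := by
    intro r
    by_cases hr : Addable μ (r + 1)
    · obtain ⟨ν, hν⟩ := rem_exists μ r hr
      exact ⟨ν, fun _ => hν⟩
    · exact ⟨⊥, fun h => absurd h hr⟩
  choose f hf using hex
  apply Finset.card_bij (fun r _ => f r)
  · intro r hr
    have := hf r (Finset.mem_filter.mp hr).2
    exact Finset.mem_filter.mpr ⟨mem_Yd.mpr (by omega), this.1⟩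
  · intro r hr s hs hrs
    have h1 := hf r (Finset.mem_filter.mp hr).2
    have h2 := hf s (Finset.mem_filter.mp hs).2
    rw [← hrs] at h2
    exact step_row_unique h1.1 h1.2.1 h1.2.2 h2.2.2
  · intro κ hκ
    obtain ⟨h1, h2⟩ := Finset.mem_filter.mp hκ
    have hc : μ.card = κ.card + 1 := by rw [mem_Yd.mp h1, h]
    obtain ⟨r, hr⟩ := step_row h2 hc
    have ha := addable_of_down h2 hc hr
    have hlt := addable_lt ha
    refine ⟨r, Finset.mem_filter.mpr ⟨Finset.mem_range.mpr (by omega), ha⟩, ?_⟩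
    have := hf r ha
    exact step_inj_down this.1 this.2.1 h2 hc this.2.2 hr

open Classical in
theorem up_eq_down {n : ℕ} {μ : YoungDiagram} (h : μ.card = n + 1) :
    ((Yd (n + 2)).filter (μ ≤ ·)).card = ((Yd n).filter (· ≤ μ)).card + 1 := by
  rw [up_card h, down_card h, Finset.card_filter, Finset.card_filter, Finset.sum_range_succ']
  simp [Addable]

theorem card_sup_inf (κ μ : YoungDiagram) : (κ ⊔ μ).card + (κ ⊓ μ).card = κ.card + μ.card := by
  have := Finset.card_union_add_card_inter κ.cells μ.cells
  simpa [YoungDiagram.card] using this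

theorem card_mono {κ μ : YoungDiagram} (h : κ ≤ μ) : κ.card ≤ μ.card := Finset.card_le_card h

theorem eq_of_le_card {κ μ : YoungDiagram} (h : κ ≤ μ) (hc : μ.card ≤ κ.card) : κ = μ :=
  YoungDiagram.ext (Finset.eq_of_subset_of_card_le h hc)

open Classical in
theorem common {n : ℕ} {κ μ : YoungDiagram} (hκ : κ.card = n + 1) (hμ : μ.card = n + 1) :
    ((Yd (n + 2)).filter (fun ν => μ ≤ ν ∧ κ ≤ ν)).card =
      ((Yd n).filter (fun ρ => ρ ≤ μ ∧ ρ ≤ κ)).card + if κ = μ then 1 else 0 := by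
  by_cases he : κ = μ
  · subst he
    simpa using up_eq_down hκ
  · have hs := card_sup_inf κ μ
    have h1 : n + 2 ≤ (κ ⊔ μ).card := by
      by_contra hcon
      have a := eq_of_le_card (le_sup_left : κ ≤ κ ⊔ μ) (by omega)
      have b := eq_of_le_card (le_sup_right : μ ≤ κ ⊔ μ) (by omega)
      exact he (a.trans b.symm)
    by_cases hc : (κ ⊔ μ).card = n + 2
    · have e1 : (Yd (n + 2)).filter (fun ν => μ ≤ ν ∧ κ ≤ ν) = {κ ⊔ μ} := by
        ext ν
        simp only [Finset.mem_filter, mem_Yd, Finset.mem_singleton]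
        constructor
        · rintro ⟨i, j, k⟩
          exact (eq_of_le_card (sup_le k j) (by omega)).symm
        · rintro rfl
          exact ⟨hc, le_sup_right, le_sup_left⟩
      have e2 : (Yd n).filter (fun ρ => ρ ≤ μ ∧ ρ ≤ κ) = {κ ⊓ μ} := by
        ext ρ
        simp only [Finset.mem_filter, mem_Yd, Finset.mem_singleton]
        constructor
        · rintro ⟨i, j, k⟩
          exact eq_of_le_card (le_inf k j) (by omega)
        · rintro rfl
          exact ⟨by omega, inf_le_right, inf_le_left⟩
      simp [e1, e2, he]
    · have e1 : (Yd (n + 2)).filter (fun ν => μ ≤ ν ∧ κ ≤ ν) = ∅ := by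
        ext ν
        simp only [Finset.mem_filter, mem_Yd, Finset.notMem_empty, iff_false]
        rintro ⟨i, j, k⟩
        have := card_mono (sup_le k j)
        omega
      have e2 : (Yd n).filter (fun ρ => ρ ≤ μ ∧ ρ ≤ κ) = ∅ := by
        ext ρ
        simp only [Finset.mem_filter, mem_Yd, Finset.notMem_empty, iff_false]
        rintro ⟨i, j, k⟩
        have := card_mono (le_inf k j)
        omega
      simp [e1, e2, he]

open Classical in
theorem sum_up : ∀ (n : ℕ) (μ : YoungDiagram), μ.card = n →
    ∑ ν ∈ (Yd (n + 1)).filter (μ ≤ ·), sytCount ν = (n + 1) * sytCount μ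
  | 0, μ, h => by
    have hμ := card_zero h
    subst hμ
    have h1 : ∀ ν ∈ (Yd (0 + 1)).filter (⊥ ≤ ·), sytCount ν = 1 := by
      intro ν hν
      rw [sytCount_rec (mem_Yd.mp (Finset.mem_filter.mp hν).1)]
      have : (Yd 0).filter (· ≤ ν) = {⊥} := by
        ext κ
        simp only [Finset.mem_filter, mem_Yd, Finset.mem_singleton]
        constructor
        · rintro ⟨a, _⟩; exact card_zero a
        · rintro rfl; exact ⟨card_bot', bot_le⟩
      rw [this, Finset.sum_singleton, sytCount_bot]
    rw [Finset.sum_congr rfl h1, Finset.sum_const, up_card h, sytCount_bot]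
    simp [Finset.card_filter, Addable]
  | (n + 1), μ, h => by
    have h1 : ∀ ν ∈ (Yd (n + 2)).filter (μ ≤ ·), sytCount ν =
        ∑ κ ∈ Yd (n + 1), if κ ≤ ν then sytCount κ else 0 := by
      intro ν hν
      rw [sytCount_rec (mem_Yd.mp (Finset.mem_filter.mp hν).1), Finset.sum_filter]
    rw [Finset.sum_congr rfl h1, Finset.sum_comm]
    have h2 : ∀ κ ∈ Yd (n + 1), (∑ ν ∈ (Yd (n + 2)).filter (μ ≤ ·), if κ ≤ ν then sytCount κ else 0)
        = (∑ ρ ∈ (Yd n).filter (· ≤ μ), if ρ ≤ κ then sytCount κ else 0) +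
          if κ = μ then sytCount κ else 0 := by
      intro κ hκ
      rw [← Finset.sum_filter, ← Finset.sum_filter, Finset.sum_const, Finset.sum_const,
        Finset.filter_filter, Finset.filter_filter, common (mem_Yd.mp hκ) h]
      split_ifs <;> simp [add_mul]
    rw [Finset.sum_congr rfl h2, Finset.sum_add_distrib, Finset.sum_comm,
      Finset.sum_ite_eq' (Yd (n + 1)) μ, if_pos (mem_Yd.mpr h)]
    have h3 : ∀ ρ ∈ (Yd n).filter (· ≤ μ), (∑ κ ∈ Yd (n + 1), if ρ ≤ κ then sytCount κ else 0) =
        (n + 1) * sytCount ρ := by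
      intro ρ hρ
      rw [← Finset.sum_filter]
      exact sum_up n ρ (mem_Yd.mp (Finset.mem_filter.mp hρ).1)
    rw [Finset.sum_congr rfl h3, ← Finset.mul_sum, ← sytCount_rec h]
    ring

open Classical in
theorem sum_sq (n : ℕ) : ∑ μ ∈ Yd n, sytCount μ * sytCount μ = n.factorial := by
  induction n with
  | zero =>
    have : Yd 0 = {⊥} := by
      ext κ
      simp only [mem_Yd, Finset.mem_singleton]
      exact ⟨card_zero, fun h => h ▸ card_bot'⟩
    simp [this, sytCount_bot]
  | succ n ih =>
    have h1 : ∀ ν ∈ Yd (n + 1), sytCount ν * sytCount ν =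
        ∑ κ ∈ Yd n, if κ ≤ ν then sytCount κ * sytCount ν else 0 := by
      intro ν hν
      conv_lhs => rw [sytCount_rec (mem_Yd.mp hν)]
      rw [Finset.sum_mul, Finset.sum_filter, ← sytCount_rec (mem_Yd.mp hν)]
    rw [Finset.sum_congr rfl h1, Finset.sum_comm, Nat.factorial_succ, ← ih, Finset.mul_sum]
    apply Finset.sum_congr rfl
    intro κ hκ
    rw [← Finset.sum_filter, ← Finset.mul_sum, sum_up n κ (mem_Yd.mp hκ)]
    ring

def goodSet {Ω : Type*} (lam : ℕ → Ω → YoungDiagram) (n : ℕ) : Set Ω :=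
  {ω | lam 0 ω = ⊥ ∧ ∀ i, i < n → lam i ω ≤ lam (i + 1) ω ∧
    (lam (i + 1) ω).card = (lam i ω).card + 1}

def segSet {Ω : Type*} (lam : ℕ → Ω → YoungDiagram) (n m : ℕ) (q : ℕ → YoungDiagram) : Set Ω :=
  {ω | ω ∈ goodSet lam n ∧ ∀ i, n ≤ i → i ≤ m → lam i ω = q i}

theorem goodSet_card {Ω : Type*} {lam : ℕ → Ω → YoungDiagram} {n : ℕ} {ω : Ω}
    (h : ω ∈ goodSet lam n) : ∀ i ≤ n, (lam i ω).card = i := by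
  intro i
  induction i with
  | zero => intro _; rw [h.1, card_bot']
  | succ i ih =>
    intro hi
    rw [(h.2 i (by omega)).2, ih (by omega)]

open Classical in
theorem seg_prob {Ω : Type*} [MeasurableSpace Ω] (P : Measure Ω)
    (lam : ℕ → Ω → YoungDiagram) (hP : IsPlancherelGrowthProcess P lam) (m : ℕ) :
    ∀ n, n ≤ m → ∀ q : ℕ → YoungDiagram, (q n).card = n →
      (∀ i, n ≤ i → i < m → q i ≤ q (i + 1) ∧ (q (i + 1)).card = (q i).card + 1) →
      MeasurableSet (segSet lam n m q) ∧
      P (segSet lam n m q) =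
        (sytCount (q n) : ENNReal) * ((sytCount (q m) : ENNReal) / (Nat.factorial m : ENNReal)) := by
  obtain ⟨_, hmeas, hpath⟩ := hP
  intro n
  induction n with
  | zero =>
    intro _ q hq0 hq
    have hq0 := card_zero hq0
    have hset : segSet lam 0 m q = {ω | ∀ i ≤ m, lam i ω = q i} := by
      ext ω
      constructor
      · intro h i hi
        exact h.2 i (Nat.zero_le _) hi
      · intro h
        refine ⟨⟨?_, fun i hi => absurd hi (by omega)⟩, fun i _ hi => h i hi⟩
        rw [h 0 (Nat.zero_le _), hq0]
    rw [hset]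
    constructor
    · have : {ω | ∀ i ≤ m, lam i ω = q i} = ⋂ i, ⋂ (_ : i ≤ m), {ω | lam i ω = q i} := by
        ext ω; simp
      rw [this]
      exact MeasurableSet.iInter fun i => MeasurableSet.iInter fun _ => hmeas i (q i)
    · rw [hpath m q hq0 (fun i hi => hq i (Nat.zero_le _) hi), hq0, sytCount_bot]
      simp
  | succ n ih =>
    intro hnm q hqn hq
    have hset : segSet lam (n + 1) m q =
        ⋃ κ ∈ (Yd n).filter (· ≤ q (n + 1)), segSet lam n m (Function.update q n κ) := by
      ext ω
      simp only [Set.mem_iUnion, Finset.mem_filter, mem_Yd, exists_prop]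
      constructor
      · rintro ⟨h1, h2⟩
        have hn := h2 (n + 1) le_rfl hnm
        refine ⟨lam n ω, ⟨goodSet_card h1 n (by omega), ?_⟩, ⟨h1.1, fun i hi => h1.2 i (by omega)⟩, ?_⟩
        · rw [← hn]
          exact (h1.2 n (by omega)).1
        · intro i hi him
          by_cases hin : i = n
          · subst hin; simp
          · rw [Function.update_of_ne hin]
            exact h2 i (by omega) him
      · rintro ⟨κ, ⟨hκ1, hκ2⟩, h1, h2⟩
        have hn : lam n ω = κ := by
          have := h2 n le_rfl (by omega)
          simpa using this
        have hrest : ∀ i, n + 1 ≤ i → i ≤ m → lam i ω = q i := by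
          intro i hi him
          have := h2 i (by omega) him
          rwa [Function.update_of_ne (by omega)] at this
        refine ⟨⟨h1.1, ?_⟩, hrest⟩
        intro i hi
        by_cases hin : i = n
        · subst hin
          rw [hn, hrest _ le_rfl hnm, hqn, hκ1]
          exact ⟨hκ2, rfl⟩
        · exact h1.2 i (by omega)
    have hone : ∀ κ ∈ (Yd n).filter (· ≤ q (n + 1)),
        MeasurableSet (segSet lam n m (Function.update q n κ)) ∧
        P (segSet lam n m (Function.update q n κ)) =
        (sytCount κ : ENNReal) * ((sytCount (q m) : ENNReal) / (Nat.factorial m : ENNReal)) := by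
      intro κ hκ
      simp only [Finset.mem_filter, mem_Yd] at hκ
      have := ih (by omega) (Function.update q n κ) (by simpa using hκ.1) (by
        intro i hi him
        by_cases hin : i = n
        · subst hin
          rw [Function.update_self, Function.update_of_ne (by omega), hqn, hκ.1]
          exact ⟨hκ.2, rfl⟩
        · rw [Function.update_of_ne hin, Function.update_of_ne (by omega)]
          exact hq i (by omega) him)
      rw [Function.update_self, Function.update_of_ne (show m ≠ n by omega)] at this
      exact this
    rw [hset]
    constructor
    · exact Finset.measurableSet_biUnion _ fun κ hκ => (hone κ hκ).1
    · rw [measure_biUnion_finset]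
      · rw [Finset.sum_congr rfl fun κ hκ => (hone κ hκ).2, ← Finset.sum_mul,
          sytCount_rec hqn]
        push_cast
        rfl
      · intro a _ b _ hab
        rw [Function.onFun, Set.disjoint_left]
        intro ω h1 h2
        apply hab
        have e1 := h1.2 n le_rfl (by omega)
        have e2 := h2.2 n le_rfl (by omega)
        rw [Function.update_self] at e1 e2
        exact e1.symm.trans e2
      · exact fun κ hκ => (hone κ hκ).1

open Classical in
theorem good_compl {Ω : Type*} [MeasurableSpace Ω] (P : Measure Ω)
    (lam : ℕ → Ω → YoungDiagram) (hP : IsPlancherelGrowthProcess P lam) (n : ℕ) :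
    P (goodSet lam n)ᶜ = 0 := by
  have hprob : IsProbabilityMeasure P := hP.1
  have hset : goodSet lam n = ⋃ μ ∈ Yd n, segSet lam n n (fun _ => μ) := by
    ext ω
    simp only [Set.mem_iUnion, mem_Yd, exists_prop]
    constructor
    · intro h
      refine ⟨lam n ω, goodSet_card h n le_rfl, h, ?_⟩
      intro i h1 h2
      rw [show i = n by omega]
    · rintro ⟨μ, _, h, _⟩
      exact h
  have hone : ∀ μ ∈ Yd n, _ := fun μ hμ => seg_prob P lam hP n n le_rfl (fun _ => μ)
    (mem_Yd.mp hμ) (fun i h1 h2 => absurd h2 (by omega))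
  have hm : MeasurableSet (goodSet lam n) := by
    rw [hset]
    exact Finset.measurableSet_biUnion _ fun κ hκ => (hone κ hκ).1
  rw [prob_compl_eq_zero_iff hm, hset, measure_biUnion_finset]
  · rw [Finset.sum_congr rfl fun κ hκ => (hone κ hκ).2]
    have := sum_sq n
    have h2 : (∑ μ ∈ Yd n, (sytCount μ : ENNReal) * (sytCount μ : ENNReal)) = (n.factorial : ENNReal) := by
      exact_mod_cast this
    simp only [div_eq_mul_inv, ← mul_assoc]
    rw [← Finset.sum_mul, h2]
    exact ENNReal.mul_inv_cancel (by exact_mod_cast n.factorial_ne_zero) (ENNReal.natCast_ne_top _)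
  · intro a _ b _ hab
    rw [Function.onFun, Set.disjoint_left]
    intro ω h1 h2
    exact hab ((h1.2 n le_rfl le_rfl).symm.trans (h2.2 n le_rfl le_rfl))
  · exact fun κ hκ => (hone κ hκ).1

open Classical in
theorem growth_le {Ω : Type*} [MeasurableSpace Ω] (P : Measure Ω)
    (lam : ℕ → Ω → YoungDiagram) (hP : IsPlancherelGrowthProcess P lam) (n r : ℕ) :
    (P (growthEvent lam n r)).toReal ≤ 1 / Real.sqrt (n + 1) := by
  have hprob : IsProbabilityMeasure P := hP.1
  set S : Finset (YoungDiagram × YoungDiagram) := (Yd n ×ˢ Yd (n + 1)).filter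
    (fun p => p.1 ≤ p.2 ∧ p.2.rowLen r = p.1.rowLen r + 1) with hS
  have hSm : ∀ p ∈ S, p.1.card = n ∧ p.2.card = n + 1 ∧ p.1 ≤ p.2 ∧
      p.2.rowLen r = p.1.rowLen r + 1 := by
    intro p hp
    simp only [hS, Finset.mem_filter, Finset.mem_product, mem_Yd] at hp
    tauto
  set Q : YoungDiagram × YoungDiagram → ℕ → YoungDiagram :=
    fun p i => if i = n then p.1 else p.2 with hQ
  have hprobS : ∀ p ∈ S, P (segSet lam n (n + 1) (Q p)) =
      (sytCount p.1 : ENNReal) * ((sytCount p.2 : ENNReal) / ((n + 1).factorial : ENNReal)) := by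
    intro p hp
    obtain ⟨h1, h2, h3, h4⟩ := hSm p hp
    have := (seg_prob P lam hP (n + 1) n (by omega) (Q p) (by simpa [hQ] using h1) (by
      intro i hi hi'
      have : i = n := by omega
      subst this
      simp only [hQ, if_true, Nat.succ_ne_self, if_false, h1, h2]
      exact ⟨h3, trivial⟩)).2
    simpa [hQ] using this
  have hsub : growthEvent lam n r ⊆ (goodSet lam (n + 1))ᶜ ∪ ⋃ p ∈ S, segSet lam n (n + 1) (Q p) := by
    intro ω hω
    by_cases hg : ω ∈ goodSet lam (n + 1)
    · right
      have hω : (lam (n + 1) ω).rowLen r = (lam n ω).rowLen r + 1 := hω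
      simp only [Set.mem_iUnion, exists_prop]
      refine ⟨(lam n ω, lam (n + 1) ω), ?_, ⟨hg.1, fun i hi => hg.2 i (by omega)⟩, ?_⟩
      · simp only [hS, Finset.mem_filter, Finset.mem_product, mem_Yd]
        exact ⟨⟨goodSet_card hg n (by omega), goodSet_card hg (n + 1) le_rfl⟩,
          (hg.2 n (by omega)).1, hω⟩
      · intro i h1 h2
        by_cases hi : i = n
        · simp [hQ, hi]
        · have : i = n + 1 := by omega
          simp [hQ, this]
    · exact Or.inl hg
  have hle : P (growthEvent lam n r) ≤ ∑ p ∈ S,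
      (sytCount p.1 : ENNReal) * ((sytCount p.2 : ENNReal) / ((n + 1).factorial : ENNReal)) := by
    calc P (growthEvent lam n r) ≤ _ := measure_mono hsub
      _ ≤ _ := measure_union_le _ _
      _ = P (⋃ p ∈ S, segSet lam n (n + 1) (Q p)) := by rw [good_compl P lam hP, zero_add]
      _ ≤ ∑ p ∈ S, P (segSet lam n (n + 1) (Q p)) := measure_biUnion_finset_le _ _
      _ = _ := Finset.sum_congr rfl hprobS
  have hreal : (P (growthEvent lam n r)).toReal ≤ ∑ p ∈ S,
      (sytCount p.1 : ℝ) * ((sytCount p.2 : ℝ) / ((n + 1).factorial : ℝ)) := by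
    have hfin : ∀ p ∈ S, (sytCount p.1 : ENNReal) *
        ((sytCount p.2 : ENNReal) / ((n + 1).factorial : ENNReal)) ≠ ⊤ := by
      intro p hp
      rw [← hprobS p hp]
      exact measure_ne_top _ _
    have := ENNReal.toReal_mono (ENNReal.sum_ne_top.mpr hfin) hle
    rw [ENNReal.toReal_sum hfin] at this
    simpa using this
  set t : ℝ := Real.sqrt (n + 1) with ht
  have htp : 0 < t := Real.sqrt_pos.mpr (by positivity)
  have htt : t * t = n + 1 := Real.mul_self_sqrt (by positivity)
  have hA : ∑ p ∈ S, (sytCount p.1 : ℝ) * (sytCount p.1 : ℝ) ≤ n.factorial := by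
    rw [← Finset.sum_image (s := S) (g := Prod.fst) (f := fun μ => (sytCount μ : ℝ) * (sytCount μ : ℝ))]
    · have h2 : (∑ μ ∈ Yd n, (sytCount μ : ℝ) * (sytCount μ : ℝ)) = n.factorial := by
        exact_mod_cast sum_sq n
      rw [← h2]
      apply Finset.sum_le_sum_of_subset_of_nonneg
      · intro μ hμ
        obtain ⟨p, hp, rfl⟩ := Finset.mem_image.mp hμ
        exact mem_Yd.mpr (hSm p hp).1
      · intros; positivity
    · rintro ⟨a, b⟩ hp ⟨a', b'⟩ hp' hpp
      have hpp : a = a' := hpp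
      subst hpp
      obtain ⟨h1, h2, h3, h4⟩ := hSm _ hp
      obtain ⟨h1', h2', h3', h4'⟩ := hSm _ hp'
      simp only at h1 h2 h3 h4 h1' h2' h3' h4'
      rw [step_inj_up h3 (by omega) h3' (by omega) h4 h4']
  have hB : ∑ p ∈ S, (sytCount p.2 : ℝ) * (sytCount p.2 : ℝ) ≤ (n + 1).factorial := by
    rw [← Finset.sum_image (s := S) (g := Prod.snd) (f := fun μ => (sytCount μ : ℝ) * (sytCount μ : ℝ))]
    · have h2 : (∑ μ ∈ Yd (n + 1), (sytCount μ : ℝ) * (sytCount μ : ℝ)) = (n + 1).factorial := by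
        exact_mod_cast sum_sq (n + 1)
      rw [← h2]
      apply Finset.sum_le_sum_of_subset_of_nonneg
      · intro μ hμ
        obtain ⟨p, hp, rfl⟩ := Finset.mem_image.mp hμ
        exact mem_Yd.mpr (hSm p hp).2.1
      · intros; positivity
    · rintro ⟨a, b⟩ hp ⟨a', b'⟩ hp' hpp
      have hpp : b = b' := hpp
      subst hpp
      obtain ⟨h1, h2, h3, h4⟩ := hSm _ hp
      obtain ⟨h1', h2', h3', h4'⟩ := hSm _ hp'
      simp only at h1 h2 h3 h4 h1' h2' h3' h4'
      rw [step_inj_down h3 (by omega) h3' (by omega) h4 h4']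
  refine hreal.trans ?_
  have hf : (((n + 1).factorial : ℕ) : ℝ) = t * t * n.factorial := by
    rw [htt, Nat.factorial_succ]; push_cast; ring
  have hfp : (0 : ℝ) < n.factorial := by exact_mod_cast n.factorial_pos
  have hC : 2 * t * ∑ p ∈ S, (sytCount p.1 : ℝ) * (sytCount p.2 : ℝ) ≤
      t * t * ∑ p ∈ S, (sytCount p.1 : ℝ) * (sytCount p.1 : ℝ) +
        ∑ p ∈ S, (sytCount p.2 : ℝ) * (sytCount p.2 : ℝ) := by
    rw [Finset.mul_sum, Finset.mul_sum, ← Finset.sum_add_distrib]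
    apply Finset.sum_le_sum
    intro p _
    nlinarith [sq_nonneg (t * (sytCount p.1 : ℝ) - (sytCount p.2 : ℝ))]
  have hD : ∑ p ∈ S, (sytCount p.1 : ℝ) * (sytCount p.2 : ℝ) ≤ t * n.factorial := by
    rw [hf] at hB
    have h1 : t * t * ∑ p ∈ S, (sytCount p.1 : ℝ) * (sytCount p.1 : ℝ) ≤ t * t * n.factorial :=
      mul_le_mul_of_nonneg_left hA (by positivity)
    have h2 : 2 * t * ∑ p ∈ S, (sytCount p.1 : ℝ) * (sytCount p.2 : ℝ) ≤
        2 * t * (t * n.factorial) := by linarith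
    exact le_of_mul_le_mul_left h2 (by positivity)
  simp only [← mul_div_assoc]
  rw [← Finset.sum_div, hf, div_le_div_iff₀ (by positivity) htp]
  have := mul_le_mul_of_nonneg_right hD htp.le
  linarith


/-- Fix `K ≥ 0` and let `s_n = ∑_{0 ≤ r ≤ K} ℙ(E_r⁽ⁿ⁾)` for `n ≥ 1`.  Then `s_n ≤ (K+1)/√n`.
(With our indexing, `s_{n+1} = ∑_{r ≤ K} ℙ(growthEvent lam n r)` so the bound is
`(K+1)/√(n+1)`.) -/
theorem sum_growth_prob_le {Ω : Type*} [MeasurableSpace Ω] (P : Measure Ω)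
    (lam : ℕ → Ω → YoungDiagram) (hPGP : IsPlancherelGrowthProcess P lam) (K : ℕ) :
    ∀ n : ℕ,
      ∑ r ∈ Finset.range (K + 1), (P (growthEvent lam n r)).toReal ≤
        (K + 1 : ℝ) / Real.sqrt (n + 1) := by
  intro n
  calc ∑ r ∈ Finset.range (K + 1), (P (growthEvent lam n r)).toReal
      ≤ ∑ r ∈ Finset.range (K + 1), 1 / Real.sqrt (n + 1) :=
        Finset.sum_le_sum fun r _ => growth_le P lam hPGP n r
    _ = (K + 1 : ℝ) / Real.sqrt (n + 1) := by
        rw [Finset.sum_const, Finset.card_range, nsmul_eq_mul]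
        push_cast
        ring
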